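/- Given any VASSB V and two semiconfigurations s1 and s2 of V, one can construct a zero-base VASSB V' such that: (1) V has an infinite progressive run starting from s1 if and only if V' has an infinite progressive run starting from s1; and (2) there is a run s1 →* s2 in V if and only if there is a run s1 →* s2 in V'. -/

import Mathlib

/-!
Formalization of context-bounded liveness for dynamic networks of concurrent
pushdown systems (DCPS) and VASS with balloons (VASSB).
Global states, stack symbols, places, balloon states etc. are drawn from ℕ;
the finite components of the systems are recorded as `Finset`s.
-/

noncomputable section

namespace CBL

/-! ### VASS with balloons (VASSB) -/

/-- A vector in `ℕ^P` (finitely supported, places drawn from `ℕ`). -/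
abbrev Vec : Type := ℕ →₀ ℕ

/-- A vector in `ℤ^P`. -/
abbrev ZVec : Type := ℕ →₀ ℤ

/-- A balloon: a balloon state together with its contents, a vector over the
balloon places. -/
abbrev Balloon : Type := ℕ × Vec

/-- A representation of a semilinear subset of `ℕ^Φ`: a finite union of
linear sets, each given by a base vector and a list of period vectors. -/
abbrev SemilinRep : Type := List (Vec × List Vec)

/-- Membership in the semilinear set denoted by a representation. -/
def memSL (k : Vec) (L : SemilinRep) : Prop :=
  ∃ bp ∈ L, ∃ cs : List ℕ, cs.length = bp.2.length ∧
    k = bp.1 + (List.zipWith (fun (c : ℕ) (v : Vec) => c • v) cs bp.2).sum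

/-- Operations labelling the edges of a VASSB. -/
inductive VOp : Type where
  | delta : ZVec → VOp
  | inflate : ℕ → SemilinRep → VOp
  | deflate : ℕ → ℕ → ℕ → ℕ → VOp
  | burst : ℕ → VOp

/-- An edge of a VASSB: source state, operation, target state. -/
abbrev VEdge : Type := ℕ × VOp × ℕ

/-- A VASS with balloons `(Q, P, Ω, Φ, E)`. -/
structure VASSB where
  states : Finset ℕ
  places : Finset ℕ
  bstates : Finset ℕ
  bplaces : Finset ℕ
  edges : Finset VEdge

/-- A configuration `(q, m, n)` of a VASSB. -/
structure VConfig where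
  q : ℕ
  m : Vec
  bag : Multiset Balloon

/-- The effect of an operation on the places and the multiset of balloons. -/
def OpRel : VOp → Vec → Multiset Balloon → Vec → Multiset Balloon → Prop
  | .delta d, m, n, m', n' =>
      (∀ p, (m' p : ℤ) = (m p : ℤ) + d p) ∧ n' = n
  | .inflate s L, m, n, m', n' =>
      m' = m ∧ ∃ k : Vec, memSL k L ∧ n' = n + {(s, k)}
  | .deflate s s' pl p, m, n, m', n' =>
      ∃ (k : Vec) (n0 : Multiset Balloon),
        n = n0 + {(s, k)} ∧ m' = m + Finsupp.single p (k pl) ∧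
        n' = n0 + {(s', Finsupp.erase pl k)}
  | .burst s, m, n, m', n' =>
      m' = m ∧ ∃ (k : Vec) (n0 : Multiset Balloon), n = n0 + {(s, k)} ∧ n' = n0

/-- The step relation induced by the edge `e`. -/
def EdgeRel (e : VEdge) (c c' : VConfig) : Prop :=
  c.q = e.1 ∧ c'.q = e.2.2 ∧ OpRel e.2.1 c.m c.bag c'.m c'.bag

/-- One step of the VASSB `V`. -/
def VStep (V : VASSB) (c c' : VConfig) : Prop :=
  ∃ e ∈ V.edges, EdgeRel e c c'

/-- Reachability in a VASSB. -/
def VReach (V : VASSB) : VConfig → VConfig → Prop :=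
  Relation.ReflTransGen (VStep V)

/-- Semiconfigurations: configurations with no balloons. -/
def IsSemi (c : VConfig) : Prop := c.bag = 0

/-- An infinite run of the VASSB `V` from `c0`, given by its sequence of
configurations and the sequence of edges taken. -/
def IsInfRunV (V : VASSB) (c0 : VConfig) (rho : ℕ → VConfig) (es : ℕ → VEdge) : Prop :=
  rho 0 = c0 ∧ ∀ i, es i ∈ V.edges ∧ EdgeRel (es i) (rho i) (rho (i + 1))

/-- A finite run of length `n` of the VASSB `V` (the first `n` steps). -/
def IsFinRunV (V : VASSB) (n : ℕ) (rho : ℕ → VConfig) (es : ℕ → VEdge) : Prop :=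
  ∀ i < n, es i ∈ V.edges ∧ EdgeRel (es i) (rho i) (rho (i + 1))

/-- The step from `c` to `c'` via the edge `e` applies a deflate or a burst
operation to (an instance of) the balloon `b`. -/
def Touches (e : VEdge) (c c' : VConfig) (b : Balloon) : Prop :=
  (∃ (s' pl p : ℕ), e.2.1 = VOp.deflate b.1 s' pl p ∧
     ∃ n0, c.bag = n0 + {b} ∧ c'.bag = n0 + {(s', Finsupp.erase pl b.2)}) ∨
  (e.2.1 = VOp.burst b.1 ∧ ∃ n0, c.bag = n0 + {b} ∧ c'.bag = n0)

/-- A progressive infinite run: every balloon present in some configuration is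
deflated or burst at some later point, and every place carrying a token is
decremented by some later edge. -/
def ProgressiveV (V : VASSB) (c0 : VConfig) (rho : ℕ → VConfig) (es : ℕ → VEdge) : Prop :=
  IsInfRunV V c0 rho es ∧
  (∀ k, ∀ b ∈ (rho k).bag, ∃ j ≥ k, Touches (es j) (rho j) (rho (j + 1)) b) ∧
  (∀ k p, (rho k).m p ≠ 0 → ∃ j ≥ k, ∃ d : ZVec, (es j).2.1 = VOp.delta d ∧ d p < 0)

/-- `V` has an infinite progressive run from `c0`. -/
def HasProgRunV (V : VASSB) (c0 : VConfig) : Prop :=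
  ∃ rho es, ProgressiveV V c0 rho es

/-- A run of a VASSB is shallow if there is a bound `B` such that every
balloon inflated along the run contains at most `B` tokens. -/
def ShallowVRun (rho : ℕ → VConfig) (es : ℕ → VEdge) : Prop :=
  ∃ B, ∀ (i : ℕ) (s : ℕ) (L : SemilinRep) (k : Vec),
    (es i).2.1 = VOp.inflate s L →
    (rho (i + 1)).bag = (rho i).bag + {(s, k)} →
    (k.sum fun _ x => x) ≤ B

/-- A VASSB is zero-base if every linear set occurring in an inflate label of
one of its edges has base vector `0`. -/
def ZeroBase (V : VASSB) : Prop :=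
  ∀ e ∈ V.edges, ∀ (s : ℕ) (L : SemilinRep), e.2.1 = VOp.inflate s L →
    ∀ bp ∈ L, bp.1 = (0 : Vec)

/-! ### The zero-base construction

Balloon states of the new system are pairs `(σ, r)`, where `r` is the part of the base vector
that has not been deflated yet; such a balloon with contents `k` stands for the balloon
`(σ, r + k)` of the original system.  Every edge of the original system is split into two: the
translated operation, leading to an intermediate state, and an edge that adds the tokens which the
base vector contributes to the deflated place. -/

/-- A coding of pairs consisting of a number and a vector by numbers. -/
def pairCode : ℕ ≃ ℕ × Vec := (nonempty_equiv_of_countable (α := ℕ) (β := ℕ × Vec)).some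

/-- The balloon obtained by adding the remaining base vector, stored in the balloon state, to
the contents. -/
def absorbBase (b : Balloon) : Balloon := ((pairCode b.1).1, (pairCode b.1).2 + b.2)

theorem absorbBase_mk (s : ℕ) (r k : Vec) :
    absorbBase (pairCode.symm (s, r), k) = (s, r + k) := by
  simp [absorbBase]

/-- The configuration obtained by adding the stored base vectors to the contents of all
balloons. -/
def absorbConfig (c : VConfig) : VConfig := ⟨c.q, c.m, c.bag.map absorbBase⟩

/-- The sum of the base vectors occurring in an operation. -/
def baseSum : VOp → Vec
  | .inflate _ L => (L.map Prod.fst).sum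
  | _ => 0

/-- A finite set of vectors, closed under erasing coordinates, that contains all base vectors
of `V`. -/
def remainders (V : VASSB) : Finset Vec := Finset.Icc 0 (∑ e ∈ V.edges, baseSum e.2.1)

open Classical in
/-- The translations of an operation, each with the vector of tokens that has to be added
afterwards. -/
def liftOps (R : Finset Vec) : VOp → Finset (VOp × Vec)
  | .delta d => {(.delta d, 0)}
  | .inflate s L =>
      L.toFinset.image fun bp => (.inflate (pairCode.symm (s, bp.1)) [(0, bp.2)], 0)
  | .deflate s s' pl p =>
      R.image fun r =>
        (.deflate (pairCode.symm (s, r)) (pairCode.symm (s', Finsupp.erase pl r)) pl p,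
          Finsupp.single p (r pl))
  | .burst s => R.image fun r => (.burst (pairCode.symm (s, r)), 0)

/-- The intermediate state in which the tokens `v` have to be added before moving to `q`. -/
def midState (M : ℕ) (v : Vec) (q : ℕ) : ℕ := M + pairCode.symm (q, v)

/-- A vector of natural numbers as a vector of integers. -/
def toZVec (v : Vec) : ZVec := v.mapRange (fun n : ℕ => (n : ℤ)) rfl

open Classical in
/-- The zero-base version of `V`, whose intermediate states are at least `M`. -/
def zeroBaseVersion (V : VASSB) (M : ℕ) : VASSB where
  states := V.states ∪ V.edges.biUnion fun e =>
    (liftOps (remainders V) e.2.1).image fun x => midState M x.2 e.2.2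
  places := V.places
  bstates := (V.bstates ×ˢ remainders V).image pairCode.symm
  bplaces := V.bplaces
  edges := V.edges.biUnion fun e => (liftOps (remainders V) e.2.1).biUnion fun x =>
    {(e.1, x.1, midState M x.2 e.2.2), (midState M x.2 e.2.2, .delta (toZVec x.2), e.2.2)}

theorem mem_zeroBaseVersion_edges {V : VASSB} {M : ℕ} {e' : VEdge} :
    e' ∈ (zeroBaseVersion V M).edges ↔
      ∃ e ∈ V.edges, ∃ op v, (op, v) ∈ liftOps (remainders V) e.2.1 ∧
        (e' = (e.1, op, midState M v e.2.2) ∨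
          e' = (midState M v e.2.2, .delta (toZVec v), e.2.2)) := by
  simp [zeroBaseVersion]

theorem midState_injective {M : ℕ} {v w : Vec} {q q' : ℕ}
    (h : midState M v q = midState M w q') : v = w ∧ q = q' := by
  have := pairCode.symm.injective (Nat.add_left_cancel h)
  simp_all

theorem le_midState (M : ℕ) (v : Vec) (q : ℕ) : M ≤ midState M v q := Nat.le_add_right _ _

theorem toZVec_apply (v : Vec) (p : ℕ) : toZVec v p = (v p : ℤ) := by
  simp [toZVec]

theorem erase_mem_remainders {V : VASSB} {r : Vec} (hr : r ∈ remainders V) (pl : ℕ) :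
    Finsupp.erase pl r ∈ remainders V := by
  simp only [remainders, Finset.mem_Icc, zero_le, true_and] at hr ⊢
  refine le_trans (fun i => ?_) hr
  by_cases h : i = pl <;> simp [Finsupp.erase, h]

theorem base_mem_remainders {V : VASSB} {e : VEdge} (he : e ∈ V.edges) {s : ℕ}
    {L : SemilinRep} (hop : e.2.1 = .inflate s L) {bp : Vec × List Vec} (hbp : bp ∈ L) :
    bp.1 ∈ remainders V := by
  simp only [remainders, Finset.mem_Icc, zero_le, true_and]
  calc bp.1 ≤ (L.map Prod.fst).sum :=
        List.single_le_sum (fun _ _ => zero_le) _ (List.mem_map_of_mem hbp)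
    _ = baseSum e.2.1 := by rw [hop, baseSum]
    _ ≤ _ := Finset.single_le_sum (f := fun e : VEdge => baseSum e.2.1)
        (fun _ _ => zero_le) he

theorem zeroBase_zeroBaseVersion (V : VASSB) (M : ℕ) : ZeroBase (zeroBaseVersion V M) := by
  intro e' he' s L hop bp hbp
  obtain ⟨e, -, op, v, hlift, rfl | rfl⟩ := mem_zeroBaseVersion_edges.1 he'
  · simp only at hop
    subst hop
    cases h : e.2.1 <;> rw [h] at hlift <;> simp [liftOps] at hlift
    obtain ⟨_, _, _, ⟨-, rfl⟩, -⟩ := hlift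
    simp_all
  · simp at hop

/-! ### From the zero-base version to the original system -/

theorem memSL_add_base {k : Vec} {bp : Vec × List Vec} {L : SemilinRep} (hbp : bp ∈ L)
    (hk : memSL k [(0, bp.2)]) : memSL (bp.1 + k) L := by
  obtain ⟨_, hmem, cs, hlen, rfl⟩ := hk
  obtain rfl := List.mem_singleton.1 hmem
  exact ⟨bp, hbp, cs, hlen, by simp⟩

theorem exists_edge_of_two_steps {V : VASSB} {M : ℕ} (hM : ∀ e ∈ V.edges, e.1 < M ∧ e.2.2 < M)
    {c c₁ c₂ : VConfig} {e₁ e₂ : VEdge} (hc : c.q < M)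
    (he₁ : e₁ ∈ (zeroBaseVersion V M).edges) (h₁ : EdgeRel e₁ c c₁)
    (he₂ : e₂ ∈ (zeroBaseVersion V M).edges) (h₂ : EdgeRel e₂ c₁ c₂) :
    c₂.q < M ∧ (∃ v, e₂.2.1 = .delta (toZVec v)) ∧
    ∃ e ∈ V.edges, EdgeRel e (absorbConfig c) (absorbConfig c₂) ∧
      (∀ b, Touches e₁ c c₁ b → Touches e (absorbConfig c) (absorbConfig c₂) (absorbBase b)) ∧
      (∀ d, e₁.2.1 = .delta d → e.2.1 = .delta d) := by
  obtain ⟨e, he, op, v, hlift, rfl | rfl⟩ := mem_zeroBaseVersion_edges.1 he₁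
  swap
  · have := le_midState M v e.2.2
    have := h₁.1
    simp only at this
    omega
  obtain ⟨f, hf, op', w, hlift', rfl | rfl⟩ := mem_zeroBaseVersion_edges.1 he₂
  · have := le_midState M v e.2.2
    have h3 := h₁.2.1
    have h4 := h₂.1
    have := (hM f hf).1
    simp only at h3 h4
    omega
  obtain ⟨rfl, hq⟩ := midState_injective (h₁.2.1.symm.trans h₂.1)
  obtain ⟨hq₁, -, hop⟩ := h₁
  obtain ⟨-, hq₂, hm₂, hb₂⟩ := h₂
  simp only [toZVec_apply] at hq₁ hq₂ hop hm₂
  have hm₂ : c₂.m = c₁.m + v := by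
    ext p
    have := hm₂ p
    simp only [Finsupp.add_apply]
    omega
  refine ⟨hq₂ ▸ (hM f hf).2, ⟨v, rfl⟩, e, he, ?_⟩
  obtain ⟨q, o, q'⟩ := e
  simp only at hlift hq₁ hq hop ⊢
  simp only [EdgeRel, absorbConfig, hq₁, hq₂, hq, hm₂, hb₂, true_and]
  cases o with
  | delta d =>
    simp only [liftOps, Finset.mem_singleton, Prod.mk.injEq] at hlift
    obtain ⟨rfl, rfl⟩ := hlift
    obtain ⟨hm, hb⟩ := hop
    refine ⟨⟨by simpa using hm, by rw [hb]⟩, fun b hb => ?_, fun d hd => hd⟩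
    simp [Touches] at hb
  | inflate s L =>
    simp only [liftOps, Finset.mem_image, List.mem_toFinset, Prod.mk.injEq] at hlift
    obtain ⟨bp, hbp, rfl, rfl⟩ := hlift
    obtain ⟨hm, k, hk, hb⟩ := hop
    refine ⟨⟨by simpa using hm, bp.1 + k, memSL_add_base hbp hk, ?_⟩, fun b hb => ?_,
      fun d hd => by simp at hd⟩
    · simp [hb, absorbBase_mk]
    · simp [Touches] at hb
  | deflate s s' pl p =>
    simp only [liftOps, Finset.mem_image, Prod.mk.injEq] at hlift
    obtain ⟨r, -, rfl, rfl⟩ := hlift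
    obtain ⟨k, n, hb, hm, hb'⟩ := hop
    refine ⟨⟨r + k, n.map absorbBase, ?_, ?_, ?_⟩, fun b hb => ?_, fun d hd => by simp at hd⟩
    · simp [hb, absorbBase_mk]
    · rw [hm, Finsupp.add_apply, Finsupp.single_add]
      abel
    · simp [hb', absorbBase_mk, Finsupp.erase_add]
    · simp only [Touches, VOp.deflate.injEq, reduceCtorEq, false_and, or_false] at hb
      obtain ⟨_, _, _, ⟨hs, rfl, rfl, rfl⟩, n, h, h'⟩ := hb
      obtain ⟨t, y⟩ := b
      obtain rfl : pairCode.symm (s, r) = t := hs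
      refine Or.inl ⟨s', pl, p, ?_, n.map absorbBase, ?_, ?_⟩
      · simp [absorbBase_mk]
      · simp [h]
      · simp [h', absorbBase_mk, Finsupp.erase_add]
  | burst s =>
    simp only [liftOps, Finset.mem_image, Prod.mk.injEq] at hlift
    obtain ⟨r, -, rfl, rfl⟩ := hlift
    obtain ⟨hm, k, n, hb, hb'⟩ := hop
    refine ⟨⟨by simpa using hm, r + k, n.map absorbBase, ?_, ?_⟩, fun b hb => ?_,
      fun d hd => by simp at hd⟩
    · simp [hb, absorbBase_mk]
    · simp [hb']
    · simp only [Touches, VOp.burst.injEq, reduceCtorEq, false_and, exists_false, false_or] at hb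
      obtain ⟨hs, n, h, h'⟩ := hb
      refine Or.inr ⟨?_, n.map absorbBase, ?_, ?_⟩
      · simp [absorbBase, ← hs]
      · simp [h]
      · simp [h']

theorem absorbConfig_of_isSemi {c : VConfig} (h : IsSemi c) : absorbConfig c = c := by
  obtain ⟨q, m, bag⟩ := c
  obtain rfl : bag = 0 := h
  rfl

theorem vReach_of_zeroBaseVersion {V : VASSB} {M : ℕ}
    (hM : ∀ e ∈ V.edges, e.1 < M ∧ e.2.2 < M) {s₁ s₂ : VConfig} (h₁ : IsSemi s₁)
    (h₂ : IsSemi s₂) (hs₁ : s₁.q < M) (hs₂ : s₂.q < M)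
    (h : VReach (zeroBaseVersion V M) s₁ s₂) : VReach V s₁ s₂ := by
  have key : ∀ c, VReach (zeroBaseVersion V M) s₁ c →
      (c.q < M ∧ VReach V s₁ (absorbConfig c)) ∨
      (M ≤ c.q ∧ ∃ c₀, c₀.q < M ∧ VReach V s₁ (absorbConfig c₀) ∧
        VStep (zeroBaseVersion V M) c₀ c) := by
    intro c hc
    induction hc with
    | refl => exact Or.inl ⟨hs₁, (absorbConfig_of_isSemi h₁).symm ▸ .refl⟩
    | @tail c d _ hstep ih =>
      obtain ⟨hq, hr⟩ | ⟨-, c₀, hq, hr, e₁, he₁, hc₁⟩ := ih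
      · by_cases hd : d.q < M
        · obtain ⟨e', he', hcd⟩ := hstep
          obtain ⟨e, -, op, v, -, rfl | rfl⟩ := mem_zeroBaseVersion_edges.1 he'
          · have := le_midState M v e.2.2
            have := hcd.2.1
            simp only at this
            omega
          · have := le_midState M v e.2.2
            have := hcd.1
            simp only at this
            omega
        · exact Or.inr ⟨not_lt.1 hd, c, hq, hr, hstep⟩
      · obtain ⟨e₂, he₂, hc₂⟩ := hstep
        obtain ⟨hq', -, e, he, hrel, -⟩ := exists_edge_of_two_steps hM hq he₁ hc₁ he₂ hc₂
        exact Or.inl ⟨hq', hr.tail ⟨e, he, hrel⟩⟩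
  obtain ⟨-, hr⟩ | ⟨hq, -⟩ := key s₂ h
  · rwa [absorbConfig_of_isSemi h₂] at hr
  · omega

theorem hasProgRunV_of_zeroBaseVersion {V : VASSB} {M : ℕ}
    (hM : ∀ e ∈ V.edges, e.1 < M ∧ e.2.2 < M) {s : VConfig} (hs : IsSemi s) (hsM : s.q < M)
    (h : HasProgRunV (zeroBaseVersion V M) s) : HasProgRunV V s := by
  obtain ⟨rho, es, ⟨h0, hrun⟩, hball, hplace⟩ := h
  have two := fun i (hi : (rho (2 * i)).q < M) =>
    exists_edge_of_two_steps hM hi (hrun (2 * i)).1 (hrun (2 * i)).2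
      (hrun (2 * i + 1)).1 (hrun (2 * i + 1)).2
  have hq : ∀ i, (rho (2 * i)).q < M := by
    intro i
    induction i with
    | zero => simpa [h0] using hsM
    | succ i ih => exact (two i ih).1
  choose hlt hpos fs hfs hrel htouch hdelta using fun i => two i (hq i)
  refine ⟨fun i => absorbConfig (rho (2 * i)), fs,
    ⟨by simp [h0, absorbConfig_of_isSemi hs], fun i => ⟨hfs i, hrel i⟩⟩, ?_, ?_⟩
  · intro k b hb
    obtain ⟨b', hb', rfl⟩ := Multiset.mem_map.1 hb
    obtain ⟨j, hj, ht⟩ := hball _ b' hb'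
    obtain ⟨i, rfl | rfl⟩ := Nat.even_or_odd' j
    · exact ⟨i, by omega, htouch i _ ht⟩
    · obtain ⟨v, hv⟩ := hpos i
      simp [Touches, hv] at ht
  · intro k p hp
    obtain ⟨j, hj, d, hd, hneg⟩ := hplace (2 * k) p hp
    obtain ⟨i, rfl | rfl⟩ := Nat.even_or_odd' j
    · exact ⟨i, by omega, d, hdelta i d hd, hneg⟩
    · obtain ⟨v, hv⟩ := hpos i
      rw [hv, VOp.delta.injEq] at hd
      rw [← hd, toZVec_apply] at hneg
      omega

/-! ### From the original system to its zero-base version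

The balloons of the zero-base version are kept in a queue.  A deflate or burst operation is applied
to the first possible balloon in the queue, so that every balloon is treated eventually. -/

/-- The queue `l` represents the multiset `n` of balloons of the original system. -/
def Represents (R : Finset Vec) (l : List Balloon) (n : Multiset Balloon) : Prop :=
  ((l.map absorbBase : List Balloon) : Multiset Balloon) = n ∧ ∀ y ∈ l, (pairCode y.1).2 ∈ R

/-- In the step from the queue `l` to the queue `l'`, every balloon for which `touched` holds
is operated upon or moves strictly forward, and no other balloon falls back. -/
def QueueStep (operated touched : Balloon → Prop) (l l' : List Balloon) : Prop :=
  ∀ (n : ℕ) (a : Balloon), l[n]? = some a →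
    operated a ∨ ∃ n' ≤ n, l'[n']? = some a ∧ (touched a → n' < n)

theorem queueStep_append {operated touched : Balloon → Prop} {l : List Balloon}
    (t : List Balloon) (h : ∀ a ∈ l, ¬ touched a) : QueueStep operated touched l (l ++ t) := by
  intro n a ha
  refine Or.inr ⟨n, le_rfl, ?_, fun ht => absurd ht (h a (List.mem_of_getElem? ha))⟩
  rw [List.getElem?_append_left (List.getElem?_eq_some_iff.1 ha).1, ha]

theorem queueStep_eraseIdx_append {operated touched : Balloon → Prop} {l : List Balloon}
    {k : ℕ} {x : Balloon} (t : List Balloon) (hx : l[k]? = some x) (hop : operated x)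
    (hfirst : ∀ n a, l[n]? = some a → touched a → k ≤ n) :
    QueueStep operated touched l (l.eraseIdx k ++ t) := by
  intro n a ha
  have hk := (List.getElem?_eq_some_iff.1 hx).1
  have hn := (List.getElem?_eq_some_iff.1 ha).1
  have hlen := List.length_eraseIdx_of_lt hk
  obtain h | rfl | h := lt_trichotomy n k
  · refine Or.inr ⟨n, le_rfl, ?_, fun ht => absurd (hfirst n a ha ht) (by omega)⟩
    rw [List.getElem?_append_left (by omega), List.getElem?_eraseIdx, if_pos h, ha]
  · rw [ha, Option.some.injEq] at hx
    exact Or.inl (hx ▸ hop)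
  · refine Or.inr ⟨n - 1, by omega, ?_, fun _ => by omega⟩
    rw [List.getElem?_append_left (by omega), List.getElem?_eraseIdx, if_neg (by omega),
      Nat.sub_add_cancel (by omega), ha]

theorem exists_first_getElem? {touched : Balloon → Prop} {l : List Balloon}
    (h : ∃ a ∈ l, touched a) :
    ∃ (k : ℕ) (x : Balloon), l[k]? = some x ∧ touched x ∧ ∀ (n : ℕ) (a : Balloon), l[n]? = some a → touched a → k ≤ n := by
  classical
  have hex : ∃ (n : ℕ) (a : Balloon), l[n]? = some a ∧ touched a := by
    obtain ⟨a, ha, ht⟩ := h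
    obtain ⟨n, hn⟩ := List.mem_iff_getElem?.1 ha
    exact ⟨n, a, hn, ht⟩
  obtain ⟨x, hx, ht⟩ := Nat.find_spec hex
  exact ⟨_, x, hx, ht, fun n a ha hta => Nat.find_min' hex ⟨a, ha, hta⟩⟩

theorem coe_eq_eraseIdx_add {l : List Balloon} {k : ℕ} {x : Balloon} (hx : l[k]? = some x) :
    (l : Multiset Balloon) = (l.eraseIdx k : List Balloon) + {x} := by
  obtain ⟨hk, rfl⟩ := List.getElem?_eq_some_iff.1 hx
  rw [add_comm, Multiset.singleton_add, Multiset.cons_coe, Multiset.coe_eq_coe]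
  exact (List.getElem_cons_eraseIdx_perm hk).symm

theorem Represents.eraseIdx {R : Finset Vec} {l : List Balloon} {n : Multiset Balloon} {k : ℕ}
    {x : Balloon} (h : Represents R l (n + {absorbBase x})) (hx : l[k]? = some x) :
    Represents R (l.eraseIdx k) n := by
  refine ⟨?_, fun y hy => h.2 y (List.mem_of_mem_eraseIdx hy)⟩
  have h1 := h.1
  rw [← Multiset.map_coe, coe_eq_eraseIdx_add hx] at h1
  simpa using h1

theorem Represents.append_singleton {R : Finset Vec} {l : List Balloon} {n : Multiset Balloon}
    {x : Balloon} (h : Represents R l n) (hx : (pairCode x.1).2 ∈ R) :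
    Represents R (l ++ [x]) (n + {absorbBase x}) := by
  refine ⟨?_, fun y hy => ?_⟩
  · rw [← h.1, List.map_append, ← Multiset.coe_add]
    rfl
  · rcases List.mem_append.1 hy with hy | hy
    · exact h.2 y hy
    · rwa [List.mem_singleton.1 hy]

theorem exists_queueStep {V : VASSB} {e : VEdge} (he : e ∈ V.edges) {c d : VConfig}
    (hcd : EdgeRel e c d) {l : List Balloon} (hl : Represents (remainders V) l c.bag) :
    ∃ l', Represents (remainders V) l' d.bag ∧
      ∃ op v m₁, (op, v) ∈ liftOps (remainders V) e.2.1 ∧ OpRel op c.m l m₁ l' ∧ d.m = m₁ + v ∧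
        (∀ q₁ q₂, QueueStep (Touches (q₁, op, q₂) ⟨q₁, c.m, l⟩ ⟨q₂, m₁, l'⟩)
          (fun a => Touches e c d (absorbBase a)) l l') ∧
        (∀ dd, e.2.1 = .delta dd → op = .delta dd) := by
  have hmem : ∀ b ∈ c.bag, ∃ a ∈ l, absorbBase a = b := by
    intro b hb
    rw [← hl.1, Multiset.mem_coe] at hb
    exact List.mem_map.1 hb
  obtain ⟨-, -, hop⟩ := hcd
  cases ho : e.2.1 with
  | delta dd =>
    rw [ho] at hop
    obtain ⟨hm, hb⟩ := hop
    refine ⟨l, hb ▸ hl, .delta dd, 0, d.m, by simp [liftOps], ⟨hm, rfl⟩, by simp,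
      fun q₁ q₂ => ?_, fun _ h => h⟩
    simpa using queueStep_append (l := l) [] fun a _ => by simp [Touches, ho]
  | inflate s L =>
    rw [ho] at hop
    obtain ⟨hm, k, ⟨bp, hbp, cs, hlen, rfl⟩, hb⟩ := hop
    set k := (List.zipWith (fun (c : ℕ) (v : Vec) => c • v) cs bp.2).sum with hk
    have habs := absorbBase_mk s bp.1 k
    refine ⟨l ++ [(pairCode.symm (s, bp.1), k)], ?_,
      .inflate (pairCode.symm (s, bp.1)) [(0, bp.2)], 0, d.m, ?_, ⟨hm, k, ?_, ?_⟩, by simp,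
      fun q₁ q₂ => ?_, fun _ h => by simp at h⟩
    · rw [hb, ← habs]
      exact hl.append_singleton (by simpa using base_mem_remainders he ho hbp)
    · simp only [liftOps, Finset.mem_image, List.mem_toFinset]
      exact ⟨bp, hbp, rfl⟩
    · exact ⟨_, List.mem_singleton_self _, cs, hlen, by simp [hk]⟩
    · rw [← Multiset.coe_add]
      rfl
    · exact queueStep_append _ fun a _ => by simp [Touches, ho]
  | deflate s s' pl p =>
    rw [ho] at hop
    obtain ⟨k, n, hb, hm, hb'⟩ := hop
    obtain ⟨a, ha, hak⟩ := hmem (s, k) (by simp [hb])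
    obtain ⟨i, x, hx, hxt, hfirst⟩ := exists_first_getElem?
      (touched := fun a => Touches e c d (absorbBase a))
      ⟨a, ha, by rw [hak]; exact Or.inl ⟨s', pl, p, ho, n, hb, hb'⟩⟩
    have hxt' := hxt
    simp only [Touches, ho, VOp.deflate.injEq, reduceCtorEq, false_and, or_false] at hxt'
    obtain ⟨_, _, _, ⟨hs, rfl, rfl, rfl⟩, n', hn, hn'⟩ := hxt'
    have hkx : k pl = (absorbBase x).2 pl := by
      have h1 := congrArg (fun n => (n.map fun b : Balloon => b.2 pl).sum) (hb.symm.trans hn)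
      have h2 := congrArg (fun n => (n.map fun b : Balloon => b.2 pl).sum) (hb'.symm.trans hn')
      simp at h1 h2
      omega
    obtain ⟨t, y⟩ := x
    obtain ⟨⟨s₀, r⟩, rfl⟩ := pairCode.symm.surjective t
    simp only [absorbBase, Equiv.apply_symm_apply] at hs hkx
    subst hs
    have hr : r ∈ remainders V := by
      simpa using hl.2 _ (List.mem_of_getElem? hx)
    have habs : absorbBase (pairCode.symm (s', Finsupp.erase pl r), Finsupp.erase pl y) =
        (s', Finsupp.erase pl (absorbBase (pairCode.symm (s, r), y)).2) := by
      simp [absorbBase, Finsupp.erase_add]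
    have hsplit := coe_eq_eraseIdx_add hx
    refine ⟨l.eraseIdx i ++ [(pairCode.symm (s', Finsupp.erase pl r), Finsupp.erase pl y)], ?_,
      .deflate (pairCode.symm (s, r)) (pairCode.symm (s', Finsupp.erase pl r)) pl p,
      Finsupp.single p (r pl), c.m + Finsupp.single p (y pl), ?_,
      ⟨y, (l.eraseIdx i : List Balloon), hsplit, rfl, ?_⟩, ?_, fun q₁ q₂ => ?_,
      fun _ h => by simp at h⟩
    · rw [hn', ← habs]
      rw [hn] at hl
      exact (hl.eraseIdx hx).append_singleton (by simpa using erase_mem_remainders hr pl)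
    · simp only [liftOps, Finset.mem_image]
      exact ⟨r, hr, rfl⟩
    · rw [← Multiset.coe_add]
      rfl
    · rw [hm, hkx, Finsupp.add_apply, Finsupp.single_add]
      abel
    · refine queueStep_eraseIdx_append _ hx (Or.inl ⟨_, pl, p, rfl, _, hsplit, ?_⟩) hfirst
      simp only [← Multiset.coe_add]
      rfl
  | burst s =>
    rw [ho] at hop
    obtain ⟨hm, k, n, hb, hb'⟩ := hop
    obtain ⟨a, ha, hak⟩ := hmem (s, k) (by simp [hb])
    obtain ⟨i, x, hx, hxt, hfirst⟩ := exists_first_getElem?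
      (touched := fun a => Touches e c d (absorbBase a))
      ⟨a, ha, by rw [hak]; exact Or.inr ⟨ho, n, hb, hb'⟩⟩
    have hxt' := hxt
    simp only [Touches, ho, VOp.burst.injEq, reduceCtorEq, false_and, exists_false,
      false_or] at hxt'
    obtain ⟨hs, n', hn, hn'⟩ := hxt'
    obtain ⟨t, y⟩ := x
    obtain ⟨⟨s₀, r⟩, rfl⟩ := pairCode.symm.surjective t
    simp only [absorbBase, Equiv.apply_symm_apply] at hs
    subst hs
    have hr : r ∈ remainders V := by
      simpa using hl.2 _ (List.mem_of_getElem? hx)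
    have hsplit := coe_eq_eraseIdx_add hx
    refine ⟨l.eraseIdx i, ?_, .burst (pairCode.symm (s, r)), 0, d.m, ?_,
      ⟨hm, y, (l.eraseIdx i : List Balloon), hsplit, rfl⟩, by simp, fun q₁ q₂ => ?_,
      fun _ h => by simp at h⟩
    · rw [hn']
      rw [hn] at hl
      exact hl.eraseIdx hx
    · simp only [liftOps, Finset.mem_image]
      exact ⟨r, hr, rfl⟩
    · simpa using queueStep_eraseIdx_append [] hx (Or.inr ⟨rfl, _, hsplit, rfl⟩) hfirst

theorem edgeRel_delta_toZVec {q q' : ℕ} {m m' v : Vec} {n : Multiset Balloon} (h : m' = m + v) :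
    EdgeRel (q, .delta (toZVec v), q') ⟨q, m, n⟩ ⟨q', m', n⟩ :=
  ⟨rfl, rfl, fun p => by simp [h, toZVec_apply], rfl⟩

theorem represents_nil (R : Finset Vec) : Represents R [] 0 := by simp [Represents]

theorem vReach_zeroBaseVersion {V : VASSB} (M : ℕ) {s₁ s₂ : VConfig} (h₁ : IsSemi s₁)
    (h₂ : IsSemi s₂) (h : VReach V s₁ s₂) : VReach (zeroBaseVersion V M) s₁ s₂ := by
  have key : ∀ c, VReach V s₁ c → ∃ l, Represents (remainders V) l c.bag ∧
      VReach (zeroBaseVersion V M) s₁ ⟨c.q, c.m, l⟩ := by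
    intro c hc
    induction hc with
    | refl =>
      obtain ⟨q, m, bag⟩ := s₁
      obtain rfl : bag = 0 := h₁
      exact ⟨[], represents_nil _, .refl⟩
    | tail _ hstep ih =>
      obtain ⟨l, hl, hr⟩ := ih
      obtain ⟨e, he, hcd⟩ := hstep
      obtain ⟨l', hl', op, v, m₁, hlift, hop, hm, -⟩ := exists_queueStep he hcd hl
      refine ⟨l', hl', (hr.tail (b := _) (c := ⟨midState M v e.2.2, m₁, l'⟩) ?_).tail ?_⟩
      · exact ⟨_, mem_zeroBaseVersion_edges.2 ⟨e, he, op, v, hlift, Or.inl rfl⟩, hcd.1, rfl, hop⟩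
      · refine ⟨_, mem_zeroBaseVersion_edges.2 ⟨e, he, op, v, hlift, Or.inr rfl⟩, ?_⟩
        rw [hcd.2.1]
        exact edgeRel_delta_toZVec hm
  obtain ⟨l, hl, hr⟩ := key s₂ h
  obtain ⟨q, m, bag⟩ := s₂
  obtain rfl : bag = 0 := h₂
  obtain rfl : l = [] := by simpa using hl.1
  exact hr

theorem exists_operated_of_queueStep {L : ℕ → List Balloon} {operated touched : ℕ → Balloon → Prop}
    (hstep : ∀ i, QueueStep (operated i) (touched i) (L i) (L (i + 1)))
    (hfair : ∀ i, ∀ a ∈ L i, ∃ j ≥ i, touched j a) {a : Balloon} :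
    ∀ i, a ∈ L i → ∃ j ≥ i, operated j a := by
  have key : ∀ n i : ℕ, (L i)[n]? = some a → ∃ j ≥ i, operated j a := by
    intro n
    induction n using Nat.strong_induction_on with
    | _ n ih =>
      have wait : ∀ t i : ℕ, (L i)[n]? = some a → touched (i + t) a → ∃ j ≥ i, operated j a := by
        intro t
        induction t with
        | zero =>
          intro i ha ht
          obtain h | ⟨n', -, ha', hlt⟩ := hstep i n a ha
          · exact ⟨i, le_rfl, h⟩
          · obtain ⟨j, hj, h⟩ := ih n' (hlt ht) (i + 1) ha'
            exact ⟨j, by omega, h⟩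
        | succ t iht =>
          intro i ha ht
          obtain h | ⟨n', hle, ha', -⟩ := hstep i n a ha
          · exact ⟨i, le_rfl, h⟩
          · obtain hlt | rfl := hle.lt_or_eq
            · obtain ⟨j, hj, h⟩ := ih n' hlt (i + 1) ha'
              exact ⟨j, by omega, h⟩
            · obtain ⟨j, hj, h⟩ := iht (i + 1) ha' (by rwa [add_right_comm, add_assoc])
              exact ⟨j, by omega, h⟩
      intro i ha
      obtain ⟨j, hj, ht⟩ := hfair i a (List.mem_of_getElem? ha)
      obtain ⟨t, rfl⟩ := Nat.exists_eq_add_of_le hj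
      exact wait t i ha ht
  intro i ha
  obtain ⟨n, hn⟩ := List.mem_iff_getElem?.1 ha
  exact key n i hn

theorem hasProgRunV_zeroBaseVersion {V : VASSB} (M : ℕ) {s : VConfig} (hs : IsSemi s)
    (h : HasProgRunV V s) : HasProgRunV (zeroBaseVersion V M) s := by
  obtain ⟨rho, es, ⟨h0, hrun⟩, hball, hplace⟩ := h
  choose next hrepr hnext using
    fun i (l : {l // Represents (remainders V) l (rho i).bag}) =>
      exists_queueStep (hrun i).1 (hrun i).2 l.2
  have hinit : Represents (remainders V) [] (rho 0).bag := by
    rw [h0, show s.bag = 0 from hs]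
    exact represents_nil _
  let L : ∀ i, {l // Represents (remainders V) l (rho i).bag} :=
    fun i => Nat.rec ⟨[], hinit⟩ (fun i l => ⟨next i l, hrepr i l⟩) i
  choose op v m₁ hlift hop hm hqueue hdelta using fun i => hnext i (L i)
  have hL : ∀ i, next i (L i) = (L (i + 1)).1 := fun _ => rfl
  simp only [hL] at hop hqueue
  let main (i : ℕ) : VConfig := ⟨(rho i).q, (rho i).m, (L i).1⟩
  let mid (i : ℕ) : VConfig := ⟨midState M (v i) (es i).2.2, m₁ i, (L (i + 1)).1⟩
  let opEdge (i : ℕ) : VEdge := ((rho i).q, op i, midState M (v i) (es i).2.2)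
  let addEdge (i : ℕ) : VEdge :=
    (midState M (v i) (es i).2.2, .delta (toZVec (v i)), (rho (i + 1)).q)
  let rho' (t : ℕ) : VConfig := if t % 2 = 0 then main (t / 2) else mid (t / 2)
  let es' (t : ℕ) : VEdge := if t % 2 = 0 then opEdge (t / 2) else addEdge (t / 2)
  have rho_even : ∀ i, rho' (2 * i) = main i := fun i => by simp [rho']
  have rho_odd : ∀ i, rho' (2 * i + 1) = mid i := fun i => by
    simp [rho', Nat.add_mod, show (2 * i + 1) / 2 = i by omega]
  have es_even : ∀ i, es' (2 * i) = opEdge i := fun i => by simp [es']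
  have es_odd : ∀ i, es' (2 * i + 1) = addEdge i := fun i => by
    simp [es', Nat.add_mod, show (2 * i + 1) / 2 = i by omega]
  have htouched : ∀ i, ∀ a ∈ (L i).1, ∃ j ≥ i, Touches (opEdge j) (main j) (mid j) a :=
    fun i a => exists_operated_of_queueStep (fun i => hqueue i _ _)
      (fun i a ha => hball i _ <| by
        rw [← (L i).2.1]
        exact List.mem_map_of_mem ha) i
  refine ⟨rho', es', ⟨?_, fun t => ?_⟩, fun t b hb => ?_, fun t p hp => ?_⟩
  · rw [show rho' 0 = main 0 from rho_even 0, ← h0]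
    have : (rho 0).bag = 0 := h0 ▸ hs
    change (⟨(rho 0).q, (rho 0).m, 0⟩ : VConfig) = rho 0
    rw [← this]
  · obtain ⟨i, rfl | rfl⟩ := Nat.even_or_odd' t
    · rw [es_even, rho_even, rho_odd]
      refine ⟨mem_zeroBaseVersion_edges.2 ⟨es i, (hrun i).1, op i, v i, hlift i, Or.inl ?_⟩,
        rfl, rfl, hop i⟩
      simp [opEdge, (hrun i).2.1]
    · rw [es_odd, rho_odd, show 2 * i + 1 + 1 = 2 * (i + 1) by ring, rho_even]
      refine ⟨mem_zeroBaseVersion_edges.2 ⟨es i, (hrun i).1, op i, v i, hlift i, Or.inr ?_⟩,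
        edgeRel_delta_toZVec (hm i)⟩
      simp [addEdge, (hrun i).2.2.1]
  · obtain ⟨i, hi, hb⟩ : ∃ i, t ≤ 2 * i ∧ b ∈ (L i).1 := by
      obtain ⟨i, rfl | rfl⟩ := Nat.even_or_odd' t
      · exact ⟨i, le_rfl, by simpa [rho_even, main] using hb⟩
      · exact ⟨i + 1, by omega, by simpa [rho_odd, mid] using hb⟩
    obtain ⟨j, hj, ht⟩ := htouched i b hb
    exact ⟨2 * j, by omega, by rwa [es_even, rho_even, rho_odd]⟩
  · obtain ⟨i, hi, hp⟩ : ∃ i, t ≤ 2 * i ∧ (rho i).m p ≠ 0 := by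
      obtain ⟨i, rfl | rfl⟩ := Nat.even_or_odd' t
      · exact ⟨i, le_rfl, by simpa [rho_even, main] using hp⟩
      · refine ⟨i + 1, by omega, ?_⟩
        rw [rho_odd] at hp
        rw [hm i, Finsupp.add_apply]
        exact fun h => hp (Nat.eq_zero_of_add_eq_zero_right h)
    obtain ⟨j, hj, d, hd, hneg⟩ := hplace i p hp
    exact ⟨2 * j, by omega, d, by rw [es_even]; exact hdelta j d hd, hneg⟩

/-- Given any VASSB `V` and two semiconfigurations `s1`, `s2`
of `V`, one can construct a zero-base VASSB `V'` such that (1) `V` has an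
infinite progressive run from `s1` iff `V'` does, and (2) there is a run
`s1 →* s2` in `V` iff there is one in `V'`. -/
theorem zero_base_construction (V : VASSB) (s1 s2 : VConfig)
    (h1 : IsSemi s1) (h2 : IsSemi s2) :
    ∃ V' : VASSB, ZeroBase V' ∧
      (HasProgRunV V s1 ↔ HasProgRunV V' s1) ∧
      (VReach V s1 s2 ↔ VReach V' s1 s2) := by
  let M := s1.q + s2.q + ∑ e ∈ V.edges, (e.1 + e.2.2) + 1
  have hM : ∀ e ∈ V.edges, e.1 < M ∧ e.2.2 < M := by
    intro e he
    have := Finset.single_le_sum (f := fun e : VEdge => e.1 + e.2.2)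
      (fun _ _ => Nat.zero_le _) he
    omega
  exact ⟨zeroBaseVersion V M, zeroBase_zeroBaseVersion V M,
    ⟨hasProgRunV_zeroBaseVersion M h1, hasProgRunV_of_zeroBaseVersion hM h1 (by omega)⟩,
    ⟨vReach_zeroBaseVersion M h1 h2,
      vReach_of_zeroBaseVersion hM h1 h2 (by omega) (by omega)⟩⟩

end CBL
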